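/- Let k be an algebraically closed field, s > 2, m ≥ 0, F = k⟨x₁,…,x_m,y₁,y₂⟩ the free associative k-algebra, and L the k-span of its generators. Let f ∈ L^{s−1} be homogeneous of degree s−1 such that y₁·f and f·y₂ are linearly independent, and assume that for every nonzero α ∈ k: f ≠ α·y₁^{s−1}, f ≠ α·y₂^{s−1}, and (if s = 2t+1) f ≠ α·(y₂y₁)^t. Set W = span{y₁·f, f·y₂}. Then ⋂_{i=0}^{s} L^i·W·L^{s−i} = 0 (intersection inside L^{2s} ⊆ F). -/

import Mathlib

noncomputable section

/-- The span `L` of the generators of the free algebra `k⟨X⟩`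
(the degree-one homogeneous component). -/
def faGens (k X : Type) [Field k] : Submodule k (FreeAlgebra k X) :=
  Submodule.span k (Set.range (FreeAlgebra.ι k : X → FreeAlgebra k X))


/-- Every contraction of `Z` against a prefix `p` and a suffix `q` of total length `n + 1` lies in
the span of the coefficient functions of `a * F` and `F * b`, where `F` has degree `n`. -/
def WindowSpan {k X : Type} [Field k] [DecidableEq X] (a b : X) (n : ℕ) (F Z : List X → k) :
    Prop :=
  ∀ p q : List X, p.length + q.length = n + 1 → ∃ α β : k, ∀ v : List X, v.length = n + 1 →
    Z (p ++ v ++ q) = α * (if v.head? = some a then F v.tail else 0) +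
      β * (if v.getLast? = some b then F v.dropLast else 0)

namespace WindowSpan

variable {k X : Type} [Field k] [DecidableEq X] {a b : X} {n : ℕ} {F Z : List X → k}

theorem reverse (H : WindowSpan a b n F Z) :
    WindowSpan b a n (fun u => F u.reverse) (fun w => Z w.reverse) := by
  intro p q hpq
  obtain ⟨α, β, h⟩ := H q.reverse p.reverse (by simpa [add_comm] using hpq)
  refine ⟨β, α, fun v hv => ?_⟩
  have := h v.reverse (by simpa using hv)
  simp only [List.reverse_append, ← List.append_assoc, this]
  simp [List.head?_reverse, List.getLast?_reverse, List.tail_reverse, List.dropLast_reverse,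
    add_comm]

theorem eval (H : WindowSpan a b n F Z) (p q : List X) (hpq : p.length + q.length = n + 1) :
    ∃ α β : k, ∀ (x : X) (r : List X) (y : X), r.length + 1 = n →
      Z (p ++ x :: (r ++ [y]) ++ q) =
        α * (if x = a then F (r ++ [y]) else 0) + β * (if y = b then F (x :: r) else 0) := by
  obtain ⟨α, β, h⟩ := H p q hpq
  refine ⟨α, β, fun x r y hr => ?_⟩
  rw [h _ (by simp [hr])]
  have : (x :: (r ++ [y])) = (x :: r) ++ [y] := rfl
  rw [this, List.getLast?_append, List.dropLast_concat]
  simp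

theorem eq_zero (H : WindowSpan a b n F Z) {p r q : List X} {x y : X} (hr : r.length + 1 = n)
    (hpq : p.length + q.length = n + 1) (hx : x ≠ a) (hy : y ≠ b) :
    Z (p ++ x :: (r ++ [y]) ++ q) = 0 := by
  obtain ⟨α, β, h⟩ := H.eval p q hpq
  rw [h x r y hr, if_neg hx, if_neg hy]
  simp

/-- If `F` has `a ^ n` in its support, a contraction is determined by its coefficients at
`a ^ (n + 1)` and `a ^ n * b`. -/
theorem eq_zero_of_eq_zero (H : WindowSpan a b n F Z) (hn : 2 ≤ n) (hab : a ≠ b)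
    (he : F (List.replicate n a) ≠ 0) {p q : List X} (hpq : p.length + q.length = n + 1)
    (h0 : Z (p ++ List.replicate (n + 1) a ++ q) = 0)
    (h1 : Z (p ++ (List.replicate n a ++ [b]) ++ q) = 0)
    {v : List X} (hv : v.length = n + 1) : Z (p ++ v ++ q) = 0 := by
  obtain ⟨α, β, h⟩ := H p q hpq
  obtain ⟨N, rfl⟩ : ∃ N, n = N + 1 := ⟨n - 1, by omega⟩
  have e0 := h (List.replicate (N + 1 + 1) a) (by simp)
  have e1 := h (List.replicate (N + 1) a ++ [b]) (by simp)
  rw [h0] at e0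
  rw [h1] at e1
  have hα : α = 0 := by
    simpa [List.getLast?_replicate, List.head?_replicate, hab, he] using e0
  have hβ : β = 0 := by
    rw [List.dropLast_concat] at e1
    simpa [hα, he] using e1
  rw [h v hv, hα, hβ]
  simp

theorem shift_eq_zero (H : WindowSpan a b n F Z) (hab : a ≠ b) (c : X) {u : List X}
    (hu : u.length = n) (hne : u ≠ List.replicate n a) :
    Z (a :: u ++ (List.replicate n a ++ [c])) = 0 := by
  obtain ⟨j, x, r, rfl, hx⟩ : ∃ (j : ℕ) (x : X) (r : List X),
      u = List.replicate j a ++ x :: r ∧ x ≠ a := by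
    clear H
    induction u generalizing n with
    | nil => simp [← hu] at hne
    | cons y u ih =>
      by_cases hy : y = a
      · subst hy
        obtain ⟨j, x, r, rfl, hx⟩ := ih (n := u.length) rfl (by
          rintro h
          apply hne
          rw [← hu, List.length_cons, List.replicate_succ, ← h])
        exact ⟨j + 1, x, r, by simp [List.replicate_succ], hx⟩
      · exact ⟨0, y, u, by simp, hy⟩
  simp at hu
  obtain ⟨i, rfl⟩ : ∃ i, n = j + 1 + i := ⟨r.length, by omega⟩
  have := H.eq_zero (p := List.replicate (j + 1) a) (r := r ++ List.replicate j a) (x := x)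
    (y := a) (q := List.replicate i a ++ [c]) (by simp; omega) (by simp; omega) hx hab
  rw [← this]
  congr 1
  have t : List.replicate (j + 1 + i) a = List.replicate j a ++ ([a] ++ List.replicate i a) := by
    rw [List.replicate_add, List.replicate_succ', List.append_assoc]
  rw [t]
  simp [List.replicate_succ]

/-- The contractions of `Z` of the form `a ^ i * _ * b ^ j`, for `F` whose coefficient at
`a ^ (n - l) * b ^ l` is `lam ^ l * e`. -/
theorem eval_staircase (H : WindowSpan a b n F Z) (hab : a ≠ b) {e lam : k}
    (hF : ∀ i l : ℕ, i + l = n → F (List.replicate i a ++ List.replicate l b) = lam ^ l * e)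
    {ζ : ℕ → k}
    (hζ : ∀ i l : ℕ, i + l = 2 * n + 2 →
      Z (List.replicate i a ++ List.replicate l b) = ζ l)
    (j : ℕ) (hj : j ≤ n + 1) :
    ∃ α β : k, ζ j = α * e ∧ ζ (j + n + 1) = β * (lam ^ n * e) ∧
      ∀ l, l + 1 ≤ n → ζ (j + l + 1) = α * (lam ^ (l + 1) * e) + β * (lam ^ l * e) := by
  obtain ⟨α, β, h⟩ := H (List.replicate (n + 1 - j) a) (List.replicate j b) (by simp; omega)
  have key : ∀ i l : ℕ, i + l = n + 1 → Z (List.replicate (n + 1 - j) a ++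
      (List.replicate i a ++ List.replicate l b) ++ List.replicate j b) = ζ (j + l) := by
    intro i l hil
    rw [← hζ (n + 1 - j + i) (j + l) (by omega)]
    congr 1
    rw [add_comm j l, List.replicate_add, List.replicate_add]
    simp only [List.append_assoc]
  refine ⟨α, β, ?_, ?_, ?_⟩
  · have h1 := h (List.replicate (n + 1) a ++ List.replicate 0 b) (by simp)
    rw [key _ _ (by simp)] at h1
    have := hF n 0 (by simp)
    simp at this
    simpa [List.getLast?_replicate, List.head?_replicate, hab, this] using h1
  · have h1 := h (List.replicate 0 a ++ List.replicate (n + 1) b) (by simp)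
    rw [key _ _ (by simp)] at h1
    have := hF 0 n (by simp)
    simp at this
    rw [show j + n + 1 = j + (n + 1) by ring, h1]
    simp [List.getLast?_replicate, hab.symm, List.head?_replicate, this]
  · intro l hl
    obtain ⟨i, hi⟩ : ∃ i, i + l + 1 = n := ⟨n - (l + 1), by omega⟩
    have h1 := h (List.replicate (i + 1) a ++ List.replicate (l + 1) b) (by simp; omega)
    rw [key _ _ (by omega)] at h1
    rw [show j + l + 1 = j + (l + 1) by ring, h1]
    have e1 := hF i (l + 1) (by omega)
    have e2 := hF (i + 1) l (by omega)
    have t : (List.replicate (i + 1) a ++ List.replicate (l + 1) b).dropLast =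
        List.replicate (i + 1) a ++ List.replicate l b := by
      rw [List.replicate_succ' (a := b), ← List.append_assoc, List.dropLast_concat]
    have t1 : (List.replicate (i + 1) a ++ List.replicate (l + 1) b).tail =
        List.replicate i a ++ List.replicate (l + 1) b := by
      simp [List.replicate_succ]
    have t2 : (List.replicate (i + 1) a ++ List.replicate (l + 1) b).head? = some a := by
      simp [List.replicate_succ]
    have t3 : (List.replicate (i + 1) a ++ List.replicate (l + 1) b).getLast? = some b := by
      simp [List.getLast?_append, List.getLast?_replicate]
    rw [t, t1, t2, t3, e1, e2]
    simp

theorem replicate_concat_eq_zero (H : WindowSpan a b n F Z) (hn : 2 ≤ n) (hab : a ≠ b)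
    (he : F (List.replicate n a) ≠ 0)
    (hne : ∃ u : List X, u.length = n ∧ u ≠ List.replicate n a ∧ F u ≠ 0)
    {c : X} (hc : c = a ∨ c = b) :
    Z (List.replicate (2 * n + 1) a ++ [c]) = 0 := by
  by_contra hZ
  obtain ⟨N, rfl⟩ : ∃ N, n = N + 1 := ⟨n - 1, by omega⟩
  obtain ⟨α, β, h⟩ := H.eval [] (List.replicate (N + 1) a ++ [c]) (by simp)
  have hα : α ≠ 0 := by
    rintro rfl
    have := h a (List.replicate N a) a (by simp)
    rw [if_neg hab, zero_mul, mul_zero, zero_add] at this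
    apply hZ
    rw [← this]
    congr 1
    rw [show 2 * (N + 1) + 1 = 1 + (N + (1 + (N + 1))) by ring, List.replicate_add,
      List.replicate_add, List.replicate_add]
    simp
  have hF : ∀ r : List X, ∀ d, r.length = N → r ++ [d] ≠ List.replicate (N + 1) a →
      α * F (r ++ [d]) + β * (if d = b then F (a :: r) else 0) = 0 := by
    intro r d hr hd
    have h1 := h a r d (by omega)
    have h2 := H.shift_eq_zero hab c (u := r ++ [d]) (by simp [hr]) hd
    rw [if_pos rfl] at h1
    rw [← h1, ← h2]
    congr 1
  set e := F (List.replicate (N + 1) a) with hedef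
  set lam : k := -β / α
  have hb : ∀ r : List X, r.length = N → F (r ++ [b]) = lam * F (a :: r) := by
    intro r hr
    have := hF r b hr (by
      intro h
      rw [List.replicate_succ'] at h
      exact hab (by simpa using (List.append_inj h (by simp [hr])).2.symm))
    simp only [if_true] at this
    simp only [lam]
    field_simp
    linear_combination this
  have hd : ∀ (r : List X) (d : X), r.length = N → d ≠ b → r ++ [d] ≠ List.replicate (N + 1) a →
      F (r ++ [d]) = 0 := by
    intro r d hr hdb hrd
    simpa [hdb, hα] using hF r d hr hrd
  have hlam : lam ≠ 0 := by
    intro h0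
    obtain ⟨u, hu, hua, hFu⟩ := hne
    obtain ⟨r, d, rfl⟩ : ∃ r d, u = r ++ [d] := by
      rcases List.eq_nil_or_concat u with rfl | ⟨r, d, rfl⟩
      · simp at hu
      · exact ⟨r, d, by simp⟩
    have hr : r.length = N := by simpa using hu
    by_cases hdb : d = b
    · subst hdb
      exact hFu (by simp [hb r hr, h0])
    · exact hFu (hd r d hr hdb hua)
  have hstair : ∀ i l : ℕ, i + l = N + 1 →
      F (List.replicate i a ++ List.replicate l b) = lam ^ l * e := by
    intro i l
    induction l generalizing i with
    | zero => rintro h; obtain rfl : i = N + 1 := by omega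
              simp [hedef]
    | succ l ih =>
      intro hil
      rw [List.replicate_succ', ← List.append_assoc, hb _ (by simp; omega), ← List.cons_append,
        ← List.replicate_succ, ih (i + 1) (by omega)]
      ring
  set ζ : ℕ → k := fun l => Z (List.replicate (2 * (N + 1) + 2 - l) a ++ List.replicate l b)
    with hζdef
  have hζ : ∀ i l : ℕ, i + l = 2 * (N + 1) + 2 →
      Z (List.replicate i a ++ List.replicate l b) = ζ l := by
    intro i l hil
    simp only [hζdef, ← hil, Nat.add_sub_cancel]
  obtain ⟨M, rfl⟩ : ∃ M, N = M + 1 := ⟨N - 1, by omega⟩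
  obtain ⟨α0, β0, p1, p2, p3⟩ := H.eval_staircase hab hstair hζ 0 (by omega)
  obtain ⟨α1, β1, q1, q2, q3⟩ := H.eval_staircase hab hstair hζ 1 (by omega)
  obtain ⟨α2, β2, -, -, r3⟩ := H.eval_staircase hab hstair hζ 2 (by omega)
  have p31 := p3 1 (by omega)
  have q30 := q3 0 (by omega)
  have q31 := q3 1 (by omega)
  have q3M := q3 (M + 1) (by omega)
  have r30 := r3 0 (by omega)
  have r3M' := r3 (M + 1) (by omega)
  ring_nf at p1 p2 p31 q1 q2 q30 q31 q3M r30 r3M'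
  have hlM : lam ^ M ≠ 0 := pow_ne_zero _ hlam
  have z0 : ζ 0 = 0 := by
    apply mul_left_cancel₀ (mul_ne_zero hlM (pow_ne_zero 3 hlam))
    linear_combination p1 * (lam ^ M * lam ^ 3) - p31 * (lam ^ M * lam) + p2 - q3M +
      q30 * (lam ^ M * lam)
  have z1 : ζ 1 = 0 := by
    apply mul_left_cancel₀ (mul_ne_zero hlM (pow_ne_zero 3 hlam))
    linear_combination (lam ^ M * lam ^ 3) * q1 - (lam ^ M * lam) * q31 + q2 - r3M' +
      (lam ^ M * lam) * r30
  rcases hc with rfl | rfl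
  · apply hZ
    rw [← z0]
    simp only [hζdef]
    rw [← List.replicate_succ']; simp
  · apply hZ
    rw [← z1]
    simp only [hζdef]
    simp

theorem all_eq_zero (H : WindowSpan a b n F Z) (hn : 2 ≤ n) (hab : a ≠ b)
    (he : F (List.replicate n a) ≠ 0)
    (hne : ∃ u : List X, u.length = n ∧ u ≠ List.replicate n a ∧ F u ≠ 0)
    {w : List X} (hw : w.length = 2 * n + 2) : Z w = 0 := by
  have ha := H.replicate_concat_eq_zero hn hab he hne (Or.inl rfl)
  have hb := H.replicate_concat_eq_zero hn hab he hne (Or.inr rfl)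
  have step0 : ∀ q : List X, q.length = n + 1 → Z (List.replicate (n + 1) a ++ q) = 0 := by
    intro q hq
    have := H.eq_zero_of_eq_zero hn hab he (p := List.replicate (n + 1) a) (q := []) (by simp)
      (by rw [← ha, ← List.replicate_succ', List.append_nil, ← List.replicate_add]
          congr 2; omega)
      (by rw [← hb, List.append_nil, ← List.append_assoc, ← List.replicate_add]
          congr 3; omega) (v := q) hq
    simpa using this
  have step1 : ∀ i j (q : List X), i + j = n + 1 → q.length = i →
      Z (List.replicate (n + j) a ++ [b] ++ q) = 0 := by
    intro i
    induction i with
    | zero =>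
      intro j q hj hq
      obtain rfl : q = [] := by simpa using hq
      obtain rfl : j = n + 1 := by omega
      rw [← hb, List.append_nil]
      congr 3; omega
    | succ i ih =>
      intro j q hj hq
      obtain ⟨y, q, rfl⟩ := List.exists_cons_of_length_eq_add_one hq
      have hq' : q.length = i := by simpa using hq
      have h1 := ih (j + 1) q (by omega) hq'
      have := H.eq_zero_of_eq_zero hn hab he (p := List.replicate (j + 1) a) (q := q)
        (by simp; omega)
        (by rw [← List.replicate_add]
            have := step0 (List.replicate (j + 1) a ++ q) (by simp; omega)
            rw [← this, ← List.append_assoc, ← List.replicate_add]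
            congr 3; omega)
        (by rw [← List.append_assoc, ← List.replicate_add]
            rw [← h1]
            congr 4; omega)
        (v := List.replicate (n - 1) a ++ [b, y]) (by simp; omega)
      rw [← this, ← List.append_assoc, ← List.replicate_add,
        show j + 1 + (n - 1) = n + j by omega]
      simp
  have := H.eq_zero_of_eq_zero hn hab he (p := []) (q := w.drop (n + 1))
    (by simp; omega) (by simpa using step0 (w.drop (n + 1)) (by simp; omega))
    (by simpa using step1 (n + 1) 0 (w.drop (n + 1)) (by omega) (by simp; omega))
    (v := w.take (n + 1)) (by simp; omega)
  simpa using this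

theorem all_eq_zero' (H : WindowSpan a b n F Z) (hn : 2 ≤ n) (hab : a ≠ b)
    (he : F (List.replicate n b) ≠ 0)
    (hne : ∃ u : List X, u.length = n ∧ u ≠ List.replicate n b ∧ F u ≠ 0)
    {w : List X} (hw : w.length = 2 * n + 2) : Z w = 0 := by
  obtain ⟨u, hu, hub, hFu⟩ := hne
  have := H.reverse.all_eq_zero hn hab.symm (by simpa using he)
    ⟨u.reverse, by simpa using hu, fun h => hub (by simpa using congrArg List.reverse h),
      by simpa using hFu⟩ (w := w.reverse) (by simpa using hw)
  simpa using this

end WindowSpan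

theorem List.eq_replicate_of_cons_eq_concat {X : Type} {x y : X} {l : List X}
    (h : x :: l = l ++ [y]) : l = List.replicate l.length x ∧ x = y := by
  induction l with
  | nil => simpa using h
  | cons z l ih =>
    simp only [List.cons_append, List.cons.injEq] at h
    obtain ⟨rfl, h⟩ := h
    obtain ⟨h1, h2⟩ := ih h
    exact ⟨by rw [List.length_cons, List.replicate_succ, ← h1], h2⟩

theorem List.eq_alternating_of_shift {X : Type} {a b : X} (hab : a ≠ b) :
    ∀ (l : List X) (c d : X), a :: c :: l = l ++ [b, d] →
      ∃ t : ℕ, c :: l = (List.replicate t [b, a]).flatten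
  | [], c, d, h => absurd (by simpa using h : a = b ∧ c = d).1 hab
  | [e], c, d, h => by
    obtain ⟨rfl, rfl, rfl⟩ : a = e ∧ c = b ∧ e = d := by simpa using h
    exact ⟨1, by simp⟩
  | e₁ :: e₂ :: l, c, d, h => by
    simp only [List.cons_append, List.cons.injEq] at h
    obtain ⟨rfl, rfl, h⟩ := h
    obtain ⟨t, ht⟩ := List.eq_alternating_of_shift hab l c d h
    have hc : c = b := by
      cases t with
      | zero => simp at ht
      | succ t => simp [List.replicate_succ] at ht; exact ht.1
    exact ⟨t + 1, by rw [List.replicate_succ, List.flatten_cons, ← ht, hc]; rfl⟩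

/-- A weight on words whose restriction to words of any fixed length is a strict order compatible
with concatenation. -/
structure IsMonomialWeight {X : Type} (ω : List X → ℤ) : Prop where
  inj : ∀ v v' : List X, v.length = v'.length → ω v = ω v' → v = v'
  le_iff : ∀ p q v v' : List X, v.length = v'.length →
    (ω (p ++ v ++ q) ≤ ω (p ++ v' ++ q) ↔ ω v ≤ ω v')

theorem IsMonomialWeight.neg {X : Type} {ω : List X → ℤ} (h : IsMonomialWeight ω) :
    IsMonomialWeight fun v => -ω v where
  inj v v' hl hv := h.inj v v' hl (neg_injective hv)
  le_iff p q v v' hl := by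
    rw [neg_le_neg_iff, neg_le_neg_iff]
    exact h.le_iff p q v' v hl.symm

theorem IsMonomialWeight.exists_weight (X : Type) [Fintype X] :
    ∃ ω : List X → ℤ, IsMonomialWeight ω := by
  let N := Fintype.card X + 2
  let d : X → ℕ := fun x => (Fintype.equivFin X x : ℕ)
  have hd : Function.Injective d := fun x y h =>
    (Fintype.equivFin X).injective (Fin.val_injective h)
  refine ⟨fun w => (Nat.ofDigits N (w.map d) : ℕ), ?_, ?_⟩
  · intro v v' hl h
    have hlt : ∀ l : List X, ∀ i ∈ l.map d, i < N := by
      intro l i hi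
      obtain ⟨x, -, rfl⟩ := List.mem_map.1 hi
      exact (Fintype.equivFin X x).2.trans (by simp [N])
    exact List.map_injective_iff.2 hd (Nat.ofDigits_inj_of_len_eq (by simp [N])
      (by simpa using hl) (hlt v) (hlt v') (by exact_mod_cast h))
  · intro p q v v' hl
    have hN : 0 < N ^ p.length := by positivity
    simp only [List.map_append, Nat.ofDigits_append, List.length_append, List.length_map, hl,
      Nat.cast_le, add_le_add_iff_right, add_le_add_iff_left]
    exact mul_le_mul_iff_right₀ hN

theorem IsMonomialWeight.exists_max {k X : Type} [Field k] [Finite X] (ω : List X → ℤ)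
    (F : List X → k) (n : ℕ) (h : ∃ u : List X, u.length = n ∧ F u ≠ 0) :
    ∃ u : List X, u.length = n ∧ F u ≠ 0 ∧
      ∀ v : List X, v.length = n → F v ≠ 0 → ω v ≤ ω u := by
  have hfin : {u : List X | u.length = n ∧ F u ≠ 0}.Finite :=
    (List.finite_length_eq X n).subset fun u hu => hu.1
  obtain ⟨u, hu, hmax⟩ := Set.exists_max_image _ ω hfin h
  exact ⟨u, hu.1, hu.2, fun v hv hFv => hmax v ⟨hv, hFv⟩⟩

namespace WindowSpan

variable {k X : Type} [Field k] [DecidableEq X] {a b : X} {n : ℕ} {F Z : List X → k}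

/-- Every window of the leading word of `Z` is one of the two leading words of the span. -/
theorem leading_window (H : WindowSpan a b n F Z) (hab : a ≠ b) {ω : List X → ℤ}
    (hω : IsMonomialWeight ω) {u : List X} (hu : u.length = n) (hFu : F u ≠ 0)
    (hmax : ∀ v : List X, v.length = n → F v ≠ 0 → ω v ≤ ω u)
    {p v q : List X} (hv : v.length = n + 1) (hpq : p.length + q.length = n + 1)
    (hZ : Z (p ++ v ++ q) ≠ 0)
    (hZmax : ∀ w : List X, w.length = 2 * n + 2 → Z w ≠ 0 → ω w ≤ ω (p ++ v ++ q)) :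
    v = a :: u ∨ v = u ++ [b] := by
  obtain ⟨α, β, h⟩ := H p q hpq
  set A : List X → k := fun v => if v.head? = some a then F v.tail else 0 with hA
  set B : List X → k := fun v => if v.getLast? = some b then F v.dropLast else 0 with hB
  have hC : ∀ v', v'.length = n + 1 → Z (p ++ v' ++ q) = α * A v' + β * B v' := h
  have hCmax : ∀ v', v'.length = n + 1 → α * A v' + β * B v' ≠ 0 → ω v' ≤ ω v := by
    intro v' hv' hne
    rw [← hC v' hv'] at hne
    exact (hω.le_iff p q v' v (by omega)).1 (hZmax _ (by simp; omega) hne)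
  have hAmax : ∀ v', v'.length = n + 1 → A v' ≠ 0 → ω v' ≤ ω (a :: u) := by
    rintro (_ | ⟨x, r⟩) hv' hne
    · simp at hv'
    · have hx : x = a := by
        by_contra hx
        exact hne (by simp [hA, hx])
      subst hx
      have := hmax r (by simpa using hv') (by simpa [hA] using hne)
      have := (hω.le_iff [x] [] r u (by simp at hv'; omega)).2 this
      simpa using this
  have hBmax : ∀ v', v'.length = n + 1 → B v' ≠ 0 → ω v' ≤ ω (u ++ [b]) := by
    intro v' hv' hne
    rcases List.eq_nil_or_concat v' with rfl | ⟨r, x, rfl⟩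
    · simp at hv'
    · have hx : x = b := by
        by_contra hx
        exact hne (by simp [hB, hx])
      subst hx
      have := hmax r (by simpa using hv') (by simpa [hB] using hne)
      have := (hω.le_iff [] [x] r u (by simp at hv'; omega)).2 this
      simpa using this
  have hAu : A (a :: u) = F u := by simp [hA]
  have hBu : B (u ++ [b]) = F u := by simp [hB]
  have hlA : (a :: u).length = n + 1 := by simp [hu]
  have hlB : (u ++ [b]).length = n + 1 := by simp [hu]
  have hne : ω (a :: u) ≠ ω (u ++ [b]) := by
    intro h
    have := congrArg (List.count a) (hω.inj _ _ (by omega) h)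
    simp [hab.symm] at this
  have hCv : α * A v + β * B v ≠ 0 := by rwa [← hC v hv]
  by_cases hcase : α ≠ 0 ∧ (β = 0 ∨ ω (u ++ [b]) < ω (a :: u))
  · left
    obtain ⟨hα, hβ⟩ := hcase
    have h0 : β * B (a :: u) = 0 := by
      rcases hβ with hβ | hβ
      · simp [hβ]
      · by_contra h0
        exact absurd (hBmax _ hlA (right_ne_zero_of_mul h0)) (not_le.2 hβ)
    have h1 : ω (a :: u) ≤ ω v := hCmax _ hlA (by rw [h0, hAu, add_zero]; exact mul_ne_zero hα hFu)
    have h2 : ω v ≤ ω (a :: u) := by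
      by_cases hAv : A v = 0
      · rw [hAv, mul_zero, zero_add] at hCv
        rcases hβ with hβ | hβ
        · simp [hβ] at hCv
        · exact (hBmax v hv (right_ne_zero_of_mul hCv)).trans hβ.le
      · exact hAmax v hv hAv
    exact hω.inj _ _ (by omega) (le_antisymm h2 h1)
  · right
    have hβ : β ≠ 0 := by
      rintro rfl
      have : α = 0 := by by_contra hα; exact hcase ⟨hα, Or.inl rfl⟩
      simp [this] at hCv
    have hα : α = 0 ∨ ω (a :: u) < ω (u ++ [b]) := by
      by_contra! hcon
      exact hcase ⟨hcon.1, Or.inr (lt_of_le_of_ne hcon.2 hne.symm)⟩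
    have h0 : α * A (u ++ [b]) = 0 := by
      rcases hα with hα | hα
      · simp [hα]
      · by_contra h0
        exact absurd (hAmax _ hlB (right_ne_zero_of_mul h0)) (not_le.2 hα)
    have h1 : ω (u ++ [b]) ≤ ω v :=
      hCmax _ hlB (by rw [h0, hBu, zero_add]; exact mul_ne_zero hβ hFu)
    have h2 : ω v ≤ ω (u ++ [b]) := by
      by_cases hBv : B v = 0
      · rw [hBv, mul_zero, add_zero] at hCv
        rcases hα with hα | hα
        · simp [hα] at hCv
        · exact (hAmax v hv (right_ne_zero_of_mul hCv)).trans hα.le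
      · exact hBmax v hv hBv
    exact hω.inj _ _ (by omega) (le_antisymm h2 h1)

theorem leading_word [Finite X] (H : WindowSpan a b n F Z) (hn : 2 ≤ n) (hab : a ≠ b)
    {ω : List X → ℤ} (hω : IsMonomialWeight ω) {u : List X} (hu : u.length = n) (hFu : F u ≠ 0)
    (hmax : ∀ v : List X, v.length = n → F v ≠ 0 → ω v ≤ ω u)
    (hZ : ∃ w : List X, w.length = 2 * n + 2 ∧ Z w ≠ 0)
    (hua : u ≠ List.replicate n a) (hub : u ≠ List.replicate n b) :
    ∃ t : ℕ, u = (List.replicate t [b, a]).flatten := by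
  obtain ⟨w, hw, hZw, hwmax⟩ := IsMonomialWeight.exists_max ω Z _ hZ
  have window : ∀ p v q : List X, w = p ++ v ++ q → v.length = n + 1 →
      v = a :: u ∨ v = u ++ [b] := by
    rintro p v q rfl hv
    exact H.leading_window hab hω hu hFu hmax hv (by simp at hw; omega) hZw hwmax
  have hne : a :: u ≠ u ++ [b] := fun h => hab (List.eq_replicate_of_cons_eq_concat h).2
  by_contra hcon
  have consecutive : ∀ (p l r : List X) (x y : X), w = p ++ x :: l ++ y :: r → l.length = n →
      x :: l = a :: u ∧ l ++ [y] = u ++ [b] := by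
    intro p l r x y h hl
    have h1 := window p (x :: l) (y :: r) h (by simp [hl])
    have h2 := window (p ++ [x]) (l ++ [y]) r (by simp [h]) (by simp [hl])
    rcases h1 with h1 | h1 <;> rcases h2 with h2 | h2
    · exfalso
      obtain ⟨rfl, rfl⟩ : x = a ∧ l = u := by simpa using h1
      apply hua
      rw [← hu]
      exact (List.eq_replicate_of_cons_eq_concat h2.symm).1
    · exact ⟨h1, h2⟩
    · exfalso
      obtain ⟨c, l', rfl⟩ := List.exists_cons_of_length_eq_add_one
        (show u.length = (n - 1) + 1 by omega)
      simp only [List.cons_append, List.cons.injEq] at h1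
      obtain ⟨rfl, rfl⟩ := h1
      exact hcon (List.eq_alternating_of_shift hab l' x y (by simpa using h2.symm))
    · exfalso
      obtain ⟨rfl, hyb⟩ := List.append_inj h2 (by omega)
      apply hub
      obtain ⟨h3, rfl⟩ := List.eq_replicate_of_cons_eq_concat h1
      rw [← hl]
      exact h3
  obtain ⟨x, w', rfl⟩ := List.exists_cons_of_length_eq_add_one hw
  obtain ⟨x', w', rfl⟩ := List.exists_cons_of_length_eq_add_one
    (show w'.length = 2 * n + 1 by simpa using hw)
  have hw' : w'.length = 2 * n := by simpa using hw
  obtain ⟨l, y, y', r, hl, rfl⟩ : ∃ (l : List X) (y y' : X) (r : List X),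
      l.length + 1 = n ∧ w' = l ++ y :: y' :: r := by
    obtain ⟨y, r, hr⟩ := List.exists_cons_of_length_eq_add_one
      (show (w'.drop (n - 1)).length = n + 1 by simp; omega)
    obtain ⟨y', r, rfl⟩ := List.exists_cons_of_length_eq_add_one
      (show r.length = (n - 1) + 1 by have := congrArg List.length hr; simp at this; omega)
    exact ⟨w'.take (n - 1), y, y', r, by simp; omega, by rw [← hr, List.take_append_drop]⟩
  have c0 := consecutive [] (x' :: l) (y' :: r) x y (by simp) (by simp [hl])
  have c1 := consecutive [x] (l ++ [y]) r x' y' (by simp) (by simp [hl])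
  exact hne (c1.1.symm.trans c0.2)

/-- If `Z` is nonzero in degree `2 * n + 2`, then `F` is supported on a single word, which is
`a ^ n`, `b ^ n` or `(b * a) ^ t`. -/
theorem eq_monomial [Fintype X] (H : WindowSpan a b n F Z) (hn : 2 ≤ n) (hab : a ≠ b)
    (hZ : ∃ w : List X, w.length = 2 * n + 2 ∧ Z w ≠ 0)
    (hF : ∃ u : List X, u.length = n ∧ F u ≠ 0) :
    ∃ u₀ : List X, (u₀ = List.replicate n a ∨ u₀ = List.replicate n b ∨
      ∃ t, n = 2 * t ∧ u₀ = (List.replicate t [b, a]).flatten) ∧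
      ∀ u : List X, u.length = n → u ≠ u₀ → F u = 0 := by
  obtain ⟨w, hw, hZw⟩ := hZ
  by_cases ha : F (List.replicate n a) = 0
  · by_cases hb : F (List.replicate n b) = 0
    · obtain ⟨ω, hω⟩ := IsMonomialWeight.exists_weight X
      obtain ⟨u₁, hu₁, hF₁, hmax₁⟩ := IsMonomialWeight.exists_max ω F n hF
      obtain ⟨u₂, hu₂, hF₂, hmax₂⟩ := IsMonomialWeight.exists_max (fun v => -ω v) F n hF
      obtain ⟨t₁, h₁⟩ := H.leading_word hn hab hω hu₁ hF₁ hmax₁ ⟨w, hw, hZw⟩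
        (by rintro rfl; exact hF₁ ha) (by rintro rfl; exact hF₁ hb)
      obtain ⟨t₂, h₂⟩ := H.leading_word hn hab hω.neg hu₂ hF₂ hmax₂ ⟨w, hw, hZw⟩
        (by rintro rfl; exact hF₂ ha) (by rintro rfl; exact hF₂ hb)
      have l₁ : n = 2 * t₁ := by rw [← hu₁, h₁]; simp [mul_comm]
      have l₂ : n = 2 * t₂ := by rw [← hu₂, h₂]; simp [mul_comm]
      obtain rfl : t₁ = t₂ := by omega
      refine ⟨u₁, Or.inr (Or.inr ⟨t₁, l₁, h₁⟩), fun u hu hne => ?_⟩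
      by_contra hFu
      have e₁ := hmax₁ u hu hFu
      have e₂ := hmax₂ u hu hFu
      rw [h₂, ← h₁, neg_le_neg_iff] at e₂
      exact hne (hω.inj _ _ (by omega) (le_antisymm e₁ e₂))
    · refine ⟨_, Or.inr (Or.inl rfl), fun u hu hne => ?_⟩
      by_contra hFu
      exact hZw (H.all_eq_zero' hn hab hb ⟨u, hu, hne, hFu⟩ hw)
  · refine ⟨_, Or.inl rfl, fun u hu hne => ?_⟩
    by_contra hFu
    exact hZw (H.all_eq_zero hn hab ha ⟨u, hu, hne, hFu⟩ hw)

end WindowSpan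

namespace FreeAlgebra

variable {k X : Type} [Field k]

/-- The coefficient of the word `w`, as a linear form on the free algebra. -/
def wordCoeff (w : List X) : FreeAlgebra k X →ₗ[k] k where
  toFun z := (equivMonoidAlgebraFreeMonoid z).coeff (FreeMonoid.ofList w)
  map_add' := by simp
  map_smul' := by simp

theorem ext_wordCoeff {z z' : FreeAlgebra k X}
    (h : ∀ w : List X, wordCoeff w z = wordCoeff w z') : z = z' := by
  apply equivMonoidAlgebraFreeMonoid.injective
  ext w
  exact h w.toList

theorem equivMonoidAlgebraFreeMonoid_ι (x : X) :
    equivMonoidAlgebraFreeMonoid (ι k x) = MonoidAlgebra.single (FreeMonoid.of x) (1 : k) := by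
  simp [equivMonoidAlgebraFreeMonoid]

theorem wordCoeff_prod_ι [DecidableEq X] (u w : List X) :
    wordCoeff w (u.map (ι k)).prod = if u = w then 1 else 0 := by
  have : equivMonoidAlgebraFreeMonoid (u.map (ι k)).prod =
      MonoidAlgebra.single (FreeMonoid.ofList u) (1 : k) := by
    induction u with
    | nil => simp [MonoidAlgebra.one_def]
    | cons x u ih =>
      rw [List.map_cons, List.prod_cons, map_mul, ih, equivMonoidAlgebraFreeMonoid_ι,
        MonoidAlgebra.single_mul_single, mul_one, FreeMonoid.ofList_cons]
  simp only [wordCoeff, LinearMap.coe_mk, AddHom.coe_mk, this, MonoidAlgebra.coeff_single]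
  classical
  rw [Finsupp.single_apply]
  exact if_congr FreeMonoid.ofList.injective.eq_iff rfl rfl

end FreeAlgebra

open FreeAlgebra

section faGens

variable {k X : Type} [Field k]

theorem faGens_pow (n : ℕ) :
    faGens k X ^ n = Submodule.span k {z | ∃ u : List X, u.length = n ∧ z = (u.map (ι k)).prod} := by
  induction n with
  | zero =>
    rw [pow_zero, Submodule.one_eq_span]
    congr 1
    ext z
    simp [List.length_eq_zero_iff]
  | succ n ih =>
    rw [pow_succ', ih, faGens, Submodule.span_mul_span]
    congr 1
    ext z
    rw [Set.mem_mul]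
    constructor
    · rintro ⟨-, ⟨x, rfl⟩, -, ⟨u, hu, rfl⟩, rfl⟩
      exact ⟨x :: u, by simp [hu], by simp⟩
    · rintro ⟨u, hu, rfl⟩
      obtain ⟨x, u, rfl⟩ := List.exists_cons_of_length_eq_add_one hu
      exact ⟨_, ⟨x, rfl⟩, _, ⟨u, by simpa using hu, rfl⟩, by simp⟩

theorem wordCoeff_eq_zero {n : ℕ} {z : FreeAlgebra k X} (hz : z ∈ faGens k X ^ n) {w : List X}
    (hw : w.length ≠ n) : wordCoeff w z = 0 := by
  classical
  rw [faGens_pow] at hz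
  induction hz using Submodule.span_induction with
  | mem z hz =>
    obtain ⟨u, hu, rfl⟩ := hz
    rw [wordCoeff_prod_ι, if_neg (by rintro rfl; exact hw hu)]
  | zero => simp
  | add y z _ _ hy hz => simp [hy, hz]
  | smul r z _ hz => simp [hz]

theorem wordCoeff_mul {i j : ℕ} {y z : FreeAlgebra k X} (hy : y ∈ faGens k X ^ i)
    (hz : z ∈ faGens k X ^ j) {p v : List X} (hp : p.length = i) :
    wordCoeff (p ++ v) (y * z) = wordCoeff p y * wordCoeff v z := by
  classical
  rw [faGens_pow] at hy hz
  induction hy using Submodule.span_induction with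
  | mem y hy =>
    obtain ⟨u, hu, rfl⟩ := hy
    induction hz using Submodule.span_induction with
    | mem z hz =>
      obtain ⟨u', hu', rfl⟩ := hz
      rw [← List.prod_append, ← List.map_append, wordCoeff_prod_ι, wordCoeff_prod_ι,
        wordCoeff_prod_ι, mul_ite, mul_one, mul_zero, ← ite_and]
      refine if_congr ⟨fun h => (List.append_inj h (by omega)).symm, ?_⟩ rfl rfl
      rintro ⟨rfl, rfl⟩
      rfl
    | zero => simp
    | add y z _ _ hy hz => simp [mul_add, hy, hz]
    | smul r z _ hz => simp [hz]; ring
  | zero => simp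
  | add y z _ _ hy hz => simp [add_mul, hy, hz]
  | smul r z _ hz => simp [hz]; ring

theorem ι_mem_faGens (x : X) : ι k x ∈ faGens k X ^ 1 := by
  rw [pow_one]
  exact Submodule.subset_span ⟨x, rfl⟩

variable [DecidableEq X]

theorem wordCoeff_ι_mul {n : ℕ} {f : FreeAlgebra k X} (hf : f ∈ faGens k X ^ n) (a : X)
    {v : List X} (hv : v.length = n + 1) :
    wordCoeff v (ι k a * f) = if v.head? = some a then wordCoeff v.tail f else 0 := by
  obtain ⟨x, v, rfl⟩ := List.exists_cons_of_length_eq_add_one hv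
  have h := wordCoeff_mul (ι_mem_faGens a) hf (p := [x]) (v := v) rfl
  have e := wordCoeff_prod_ι (k := k) [a] [x]
  simp only [List.map_cons, List.map_nil, List.prod_cons, List.prod_nil, mul_one] at e
  rw [e] at h
  simpa [eq_comm] using h

theorem wordCoeff_mul_ι {n : ℕ} {f : FreeAlgebra k X} (hf : f ∈ faGens k X ^ n) (b : X)
    {v : List X} (hv : v.length = n + 1) :
    wordCoeff v (f * ι k b) = if v.getLast? = some b then wordCoeff v.dropLast f else 0 := by
  rcases List.eq_nil_or_concat v with rfl | ⟨v, x, rfl⟩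
  · simp at hv
  have h := wordCoeff_mul hf (ι_mem_faGens b) (p := v) (v := [x]) (by simpa using hv)
  have e := wordCoeff_prod_ι (k := k) [b] [x]
  simp only [List.map_cons, List.map_nil, List.prod_cons, List.prod_nil, mul_one] at e
  rw [e] at h
  simpa [eq_comm] using h

/-- An element of the intersection of the `L ^ i * W * L ^ (n + 1 - i)` has all its contractions
in `W`. -/
theorem windowSpan_wordCoeff {n : ℕ} {f : FreeAlgebra k X} (hf : f ∈ faGens k X ^ n) (a b : X)
    {z : FreeAlgebra k X}
    (hz : ∀ i ≤ n + 1, z ∈ faGens k X ^ i * Submodule.span k {ι k a * f, f * ι k b} *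
      faGens k X ^ (n + 1 - i)) :
    WindowSpan a b n (fun u => wordCoeff u f) (fun w => wordCoeff w z) := by
  intro p q hpq
  replace hz := hz p.length (by omega)
  rw [show n + 1 - p.length = q.length by omega] at hz
  have haf : ι k a * f ∈ faGens k X ^ (n + 1) := by
    rw [add_comm, pow_add]
    exact Submodule.mul_mem_mul (ι_mem_faGens a) hf
  have hfb : f * ι k b ∈ faGens k X ^ (n + 1) := by
    rw [pow_add]
    exact Submodule.mul_mem_mul hf (ι_mem_faGens b)
  suffices ∃ α β : k, ∀ v : List X, v.length = n + 1 →
      wordCoeff (p ++ v ++ q) z =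
        α * wordCoeff v (ι k a * f) + β * wordCoeff v (f * ι k b) by
    obtain ⟨α, β, h⟩ := this
    refine ⟨α, β, fun v hv => ?_⟩
    simp only [h v hv, wordCoeff_ι_mul hf a hv, wordCoeff_mul_ι hf b hv]
  induction hz using Submodule.mul_induction_on' with
  | mem_mul_mem y hy c hc =>
    induction hy using Submodule.mul_induction_on' with
    | mem_mul_mem d hd w hw =>
      obtain ⟨α, β, rfl⟩ := Submodule.mem_span_pair.1 hw
      refine ⟨wordCoeff p d * wordCoeff q c * α, wordCoeff p d * wordCoeff q c * β,
        fun v hv => ?_⟩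
      have hw' := Submodule.add_mem _ (Submodule.smul_mem _ α haf) (Submodule.smul_mem _ β hfb)
      rw [wordCoeff_mul (i := p.length + (n + 1))
        (by rw [pow_add]; exact Submodule.mul_mem_mul hd hw') hc (by simp [hv]),
        wordCoeff_mul hd hw' rfl]
      simp only [map_add, map_smul, smul_eq_mul]
      ring
    | add y _ y' _ h h' =>
      obtain ⟨α, β, h⟩ := h
      obtain ⟨α', β', h'⟩ := h'
      refine ⟨α + α', β + β', fun v hv => ?_⟩
      rw [add_mul, map_add, h v hv, h' v hv]
      ring
  | add y _ y' _ h h' =>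
    obtain ⟨α, β, h⟩ := h
    obtain ⟨α', β', h'⟩ := h'
    refine ⟨α + α', β + β', fun v hv => ?_⟩
    rw [map_add, h v hv, h' v hv]
    ring

/-- A homogeneous element supported on a single word is a scalar multiple of it. -/
theorem eq_smul_prod_ι {n : ℕ} {f : FreeAlgebra k X} (hf : f ∈ faGens k X ^ n) {u₀ : List X}
    (h : ∀ u : List X, u.length = n → u ≠ u₀ → wordCoeff u f = 0) :
    f = wordCoeff u₀ f • (u₀.map (ι k)).prod := by
  apply ext_wordCoeff
  intro w
  rw [map_smul, wordCoeff_prod_ι, smul_eq_mul]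
  split_ifs with hw
  · rw [hw, mul_one]
  · rw [mul_zero]
    by_cases hl : w.length = n
    · exact h w hl (Ne.symm hw)
    · exact wordCoeff_eq_zero hf hl

end faGens

/-- Let `k` be an algebraically closed field, `s > 2`, `m ≥ 0`,
`F = k⟨x₁,…,x_m,y₁,y₂⟩` (with `y₁, y₂` the generators indexed by `Sum.inr 0, Sum.inr 1`)
and `L` the span of the generators.  Let `f ∈ L^{s−1}` be such that `y₁·f` and `f·y₂`
are linearly independent, and assume that for every nonzero `α ∈ k`: `f ≠ α·y₁^{s−1}`,
`f ≠ α·y₂^{s−1}`, and (if `s = 2t+1`) `f ≠ α·(y₂y₁)^t`.  With `W = span{y₁·f, f·y₂}`,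
one has `⋂_{i=0}^{s} L^i·W·L^{s−i} = 0` inside `L^{2s} ⊆ F`. -/
theorem stmt15 (k : Type) [Field k] [IsAlgClosed k] (s m : ℕ) (hs : 2 < s)
    (f : FreeAlgebra k (Fin m ⊕ Fin 2))
    (hf : f ∈ faGens k (Fin m ⊕ Fin 2) ^ (s - 1))
    (hli : LinearIndependent k
      ![FreeAlgebra.ι k (Sum.inr 0 : Fin m ⊕ Fin 2) * f,
        f * FreeAlgebra.ι k (Sum.inr 1 : Fin m ⊕ Fin 2)])
    (h1 : ∀ α : k, α ≠ 0 →
      f ≠ α • FreeAlgebra.ι k (Sum.inr 0 : Fin m ⊕ Fin 2) ^ (s - 1))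
    (h2 : ∀ α : k, α ≠ 0 →
      f ≠ α • FreeAlgebra.ι k (Sum.inr 1 : Fin m ⊕ Fin 2) ^ (s - 1))
    (h3 : ∀ α : k, α ≠ 0 → ∀ t : ℕ, s = 2 * t + 1 →
      f ≠ α • (FreeAlgebra.ι k (Sum.inr 1 : Fin m ⊕ Fin 2) *
        FreeAlgebra.ι k (Sum.inr 0 : Fin m ⊕ Fin 2)) ^ t) :
    (⨅ i : Fin (s + 1), faGens k (Fin m ⊕ Fin 2) ^ (i : ℕ) *
        Submodule.span k
          {FreeAlgebra.ι k (Sum.inr 0 : Fin m ⊕ Fin 2) * f,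
           f * FreeAlgebra.ι k (Sum.inr 1 : Fin m ⊕ Fin 2)} *
        faGens k (Fin m ⊕ Fin 2) ^ (s - (i : ℕ))) = ⊥ := by
  obtain ⟨n, rfl⟩ : ∃ n, s = n + 1 := ⟨s - 1, by omega⟩
  rw [Nat.add_sub_cancel] at hf h1 h2
  have hf0 : f ≠ 0 := by
    rintro rfl
    exact hli.ne_zero 0 (by simp)
  have hsupp : ∃ u : List (Fin m ⊕ Fin 2), u.length = n ∧ wordCoeff u f ≠ 0 := by
    by_contra! hcon
    refine hf0 (ext_wordCoeff fun w => ?_)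
    by_cases hw : w.length = n
    · rw [hcon w hw, map_zero]
    · rw [wordCoeff_eq_zero hf hw, map_zero]
  rw [eq_bot_iff]
  intro z hz
  rw [Submodule.mem_iInf] at hz
  have H := windowSpan_wordCoeff hf (Sum.inr 0) (Sum.inr 1) fun i hi =>
    hz ⟨i, Nat.lt_succ_of_le hi⟩
  rw [Submodule.mem_bot]
  by_contra hz0
  have hZ : ∃ w : List (Fin m ⊕ Fin 2), w.length = 2 * n + 2 ∧ wordCoeff w z ≠ 0 := by
    by_contra! hcon
    refine hz0 (ext_wordCoeff fun w => ?_)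
    rw [map_zero]
    by_cases hw : w.length = 2 * n + 2
    · exact hcon w hw
    · have hzn : z ∈ faGens k (Fin m ⊕ Fin 2) ^ (2 * n + 2) := by
        have hW : Submodule.span k {ι k (Sum.inr 0 : Fin m ⊕ Fin 2) * f,
            f * ι k (Sum.inr 1 : Fin m ⊕ Fin 2)} ≤ faGens k (Fin m ⊕ Fin 2) ^ (n + 1) := by
          rw [Submodule.span_le]
          rintro _ (rfl | rfl)
          · rw [add_comm, pow_add]
            exact Submodule.mul_mem_mul (ι_mem_faGens _) hf
          · rw [pow_add]
            exact Submodule.mul_mem_mul hf (ι_mem_faGens _)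
        have h0 := hz 0
        rw [Fin.val_zero, pow_zero, one_mul, Nat.sub_zero] at h0
        rw [show 2 * n + 2 = (n + 1) + (n + 1) by ring, pow_add]
        exact mul_le_mul_left hW _ h0
      exact wordCoeff_eq_zero hzn hw
  obtain ⟨u₀, hu₀, h⟩ := H.eq_monomial (by omega) (by simp) hZ hsupp
  have hfu := eq_smul_prod_ι hf h
  have hα : wordCoeff u₀ f ≠ 0 := by
    intro h0
    rw [h0, zero_smul] at hfu
    exact hf0 hfu
  rcases hu₀ with rfl | rfl | ⟨t, hn, rfl⟩
  · exact h1 _ hα (by simpa using hfu)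
  · exact h2 _ hα (by simpa using hfu)
  · refine h3 _ hα t (by omega) (hfu.trans ?_)
    congr 1
    simp [List.map_flatten, List.prod_flatten]

end
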